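/- arXiv:2512.05570 — 3 statements merged into one kernel-verified Lean document; each statement's English description precedes it below -/
import Mathlib

section
/- Let R be a principal ideal domain, let K be a field equipped with an R-algebra structure via a ring homomorphism f : R → K, and let M be a finitely generated R-module. Assume there exists r ∈ R with f(r) ≠ 0 such that r • t = 0 for every torsion element t of M (i.e., r annihilates the torsion submodule of M). Then dim_K(K ⊗_R M) = dim_{Frac(R)}(Frac(R) ⊗_R M). -/
open TensorProduct

/-- If `r` annihilates `N` and becomes invertible in `A`, then `A ⊗[R] N` is trivial. -/
theorem TensorProduct.subsingleton_of_isUnit_of_smul_eq_zero {R A N : Type*} [CommRing R]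
    [CommRing A] [Algebra R A] [AddCommGroup N] [Module R N] {r : R}
    (hr : IsUnit (algebraMap R A r)) (hN : ∀ n : N, r • n = 0) : Subsingleton (A ⊗[R] N) := by
  refine subsingleton_of_forall_eq 0 fun x => ?_
  induction x with
  | zero => rfl
  | add x y hx hy => rw [hx, hy, add_zero]
  | tmul a n =>
    obtain ⟨b, rfl⟩ := hr.dvd (a := a)
    rw [← _root_.Algebra.smul_def, TensorProduct.smul_tmul, hN, TensorProduct.tmul_zero]

/-- If `r` annihilates the submodule `N` and becomes invertible in `A`, then `M → M ⧸ N` becomes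
bijective after base change to `A`. -/
theorem Submodule.baseChange_mkQ_bijective {R A M : Type*} [CommRing R] [CommRing A] [Algebra R A]
    [AddCommGroup M] [Module R M] (N : Submodule R M) {r : R} (hr : IsUnit (algebraMap R A r))
    (hN : ∀ n ∈ N, r • n = 0) : Function.Bijective (N.mkQ.baseChange A) := by
  have : Subsingleton (A ⊗[R] N) :=
    TensorProduct.subsingleton_of_isUnit_of_smul_eq_zero hr fun n => Subtype.ext (hN n n.2)
  refine ⟨(injective_iff_map_eq_zero _).2 fun x hx => ?_,
    LinearMap.lTensor_surjective A N.mkQ_surjective⟩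
  obtain ⟨y, rfl⟩ := (lTensor_exact A (LinearMap.exact_subtype_mkQ N) N.mkQ_surjective x).1 hx
  rw [Subsingleton.elim y 0, map_zero]

/-- Over a PID, if an annihilator of the torsion of a finite module `M` is nonzero in a field `L`,
then the dimension of `L ⊗[R] M` is the rank of `M` modulo torsion. -/
theorem Module.finrank_baseChange_eq_finrank_quotient_torsion {R : Type*} [CommRing R] [IsDomain R]
    [IsPrincipalIdealRing R] (L : Type*) [Field L] [Algebra R L] (M : Type*) [AddCommGroup M]
    [Module R M] [Module.Finite R M] {r : R} (hr : algebraMap R L r ≠ 0)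
    (h : ∀ t ∈ Submodule.torsion R M, r • t = 0) :
    Module.finrank L (L ⊗[R] M) = Module.finrank R (M ⧸ Submodule.torsion R M) := by
  rw [(LinearEquiv.ofBijective _
    ((Submodule.torsion R M).baseChange_mkQ_bijective hr.isUnit h)).finrank_eq,
    Module.finrank_baseChange]

/-- Let `R` be a PID, `K` a field which is an `R`-algebra, and `M` a finitely generated
`R`-module. If some `r : R` with nonzero image in `K` annihilates the torsion submodule
of `M`, then the fiber dimension `dim_K (K ⊗[R] M)` equals the generic rank
`dim_{Frac R} (Frac R ⊗[R] M)`. -/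
theorem stmt_1 (R : Type*) [CommRing R] [IsDomain R] [IsPrincipalIdealRing R]
    (K : Type*) [Field K] [Algebra R K]
    (M : Type*) [AddCommGroup M] [Module R M] [Module.Finite R M]
    (h : ∃ r : R, algebraMap R K r ≠ 0 ∧
      ∀ t ∈ Submodule.torsion R M, r • t = 0) :
    Module.finrank K (K ⊗[R] M) =
      Module.finrank (FractionRing R) (FractionRing R ⊗[R] M) := by
  obtain ⟨r, hr, ht⟩ := h
  have hr' : algebraMap R (FractionRing R) r ≠ 0 := by
    rw [Ne, FaithfulSMul.algebraMap_eq_zero_iff]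
    rintro rfl
    exact hr (map_zero _)
  rw [Module.finrank_baseChange_eq_finrank_quotient_torsion K M hr ht,
    Module.finrank_baseChange_eq_finrank_quotient_torsion (FractionRing R) M hr' ht]
end

section
/- Let R be a commutative ring, M a finitely generated R-module, and n a natural number. Then the set of prime ideals 𝔭 of R such that dim_{κ(𝔭)}(κ(𝔭) ⊗_R M) ≤ n is open in the prime spectrum Spec(R) with its Zariski topology. Equivalently, the function 𝔭 ↦ dim_{κ(𝔭)}(κ(𝔭) ⊗_R M) is upper semicontinuous on Spec(R). -/
open TensorProduct

/-- The base change of a submodule `N` of `M` to `A` is everything if and only if the base change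
of `M ⧸ N` vanishes. -/
theorem Submodule.baseChange_eq_top_iff_subsingleton {R : Type*} [CommRing R] (A : Type*)
    [CommRing A] [Algebra R A] {M : Type*} [AddCommGroup M] [Module R M] (N : Submodule R M) :
    N.baseChange A = ⊤ ↔ Subsingleton (A ⊗[R] (M ⧸ N)) := by
  have hexact : Function.Exact (N.subtype.lTensor A) (N.mkQ.lTensor A) :=
    lTensor_exact A (LinearMap.exact_subtype_mkQ N) N.mkQ_surjective
  have hsurj : Function.Surjective (N.mkQ.lTensor A) :=
    LinearMap.lTensor_surjective A N.mkQ_surjective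
  have hmem (x : A ⊗[R] M) : x ∈ N.baseChange A ↔ N.mkQ.lTensor A x = 0 := (hexact x).symm
  refine ⟨fun h ↦ subsingleton_of_forall_eq 0 fun y ↦ ?_, fun h ↦ ?_⟩
  · obtain ⟨x, rfl⟩ := hsurj y
    exact (hmem x).1 (h ▸ Submodule.mem_top)
  · exact eq_top_iff.2 fun x _ ↦ (hmem x).2 (Subsingleton.elim _ _)

/-- A prime lies outside the support of `M ⧸ span R s` if and only if `s` spans the fiber of `M`
at that prime. -/
theorem Module.notMem_support_quotient_span_iff {R : Type*} [CommRing R] {M : Type*}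
    [AddCommGroup M] [Module R M] [Module.Finite R M] (s : Set M) (p : PrimeSpectrum R) :
    p ∉ Module.support R (M ⧸ Submodule.span R s) ↔
      Submodule.span p.asIdeal.ResidueField
        (TensorProduct.mk R p.asIdeal.ResidueField M 1 '' s) = ⊤ := by
  rw [Module.mem_support_iff_nontrivial_residueField_tensorProduct,
    not_nontrivial_iff_subsingleton, ← Submodule.baseChange_eq_top_iff_subsingleton,
    Submodule.baseChange_span]

/-- A finite-dimensional base change `K ⊗[R] M` to a field has a basis consisting of images of
elements of `M`. -/
theorem TensorProduct.exists_finset_card_eq_finrank_span_eq_top {R : Type*} [CommRing R]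
    (K : Type*) [Field K] [Algebra R K] (M : Type*) [AddCommGroup M] [Module R M]
    [Module.Finite K (K ⊗[R] M)] :
    ∃ s : Finset M, s.card = Module.finrank K (K ⊗[R] M) ∧
      Submodule.span K (TensorProduct.mk R K M 1 '' s) = ⊤ := by
  classical
  obtain ⟨b, hb, hspan, hind⟩ := exists_linearIndependent K (Set.range (TensorProduct.mk R K M 1))
  have hb_top : Submodule.span K b = ⊤ := by
    rw [hspan, ← Set.image_univ, ← Submodule.baseChange_span, Submodule.span_univ,
      Submodule.baseChange_top]
  obtain ⟨s, rfl, hinj⟩ := Set.exists_image_eq_injOn_of_subset_range hb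
  have hfin : s.Finite := Set.Finite.of_finite_image hind.setFinite hinj
  lift s to Finset M using hfin
  refine ⟨s, ?_, hb_top⟩
  rw [← finrank_top, ← hb_top, ← Finset.coe_image, finrank_span_finset_eq_card,
    Finset.card_image_of_injOn hinj]
  rwa [Finset.coe_image]

/-- Upper semicontinuity of the fiber dimension: for a finitely generated module `M`
over a commutative ring `R` and any `n : ℕ`, the set of primes `𝔭` with
`dim_{κ(𝔭)} (κ(𝔭) ⊗[R] M) ≤ n` is Zariski-open in `Spec R`, where `κ(𝔭)` is the
residue field of the localization of `R` at `𝔭`. -/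
theorem stmt_2 (R : Type*) [CommRing R]
    (M : Type*) [AddCommGroup M] [Module R M] [Module.Finite R M] (n : ℕ) :
    IsOpen {𝔭 : PrimeSpectrum R |
      Module.finrank (IsLocalRing.ResidueField (Localization.AtPrime 𝔭.asIdeal))
        (IsLocalRing.ResidueField (Localization.AtPrime 𝔭.asIdeal) ⊗[R] M) ≤ n} := by
  classical
  refine isOpen_iff_forall_mem_open.2 fun p hp ↦ ?_
  obtain ⟨s, hcard, hs⟩ :=
    TensorProduct.exists_finset_card_eq_finrank_span_eq_top (R := R) p.asIdeal.ResidueField M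
  refine ⟨(Module.support R (M ⧸ Submodule.span R (s : Set M)))ᶜ, fun q hq ↦ ?_,
    Module.isClosed_support.isOpen_compl, (Module.notMem_support_quotient_span_iff _ p).2 hs⟩
  have hq_top := (Module.notMem_support_quotient_span_iff _ q).1 hq
  rw [← Finset.coe_image] at hq_top
  calc Module.finrank q.asIdeal.ResidueField (q.asIdeal.ResidueField ⊗[R] M)
      ≤ (s.image (TensorProduct.mk R q.asIdeal.ResidueField M 1)).card := by
        rw [← finrank_top, ← hq_top]
        exact finrank_span_finset_le_card _
    _ ≤ s.card := Finset.card_image_le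
    _ ≤ n := hcard.trans_le hp
end

section
/- Let R be a commutative integral domain, M a finitely generated R-module, K a field, and f : R → K a ring homomorphism, making K an R-algebra. Then dim_{Frac(R)}(Frac(R) ⊗_R M) ≤ dim_K(K ⊗_R M). -/
open TensorProduct

/-- Over a local ring, the fiber dimension of a finite module at a field-valued point is at most
the dimension of its closed fiber. -/
theorem IsLocalRing.finrank_tensorProduct_le_finrank_residueField (A N F : Type*) [CommRing A]
    [IsLocalRing A] [AddCommGroup N] [Module A N] [Module.Finite A N] [Field F] [Algebra A F] :
    Module.finrank F (F ⊗[A] N) ≤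
      Module.finrank (ResidueField A) (ResidueField A ⊗[A] N) := by
  let b := Module.finBasis (ResidueField A) (ResidueField A ⊗[A] N)
  choose v hv using fun i ↦ TensorProduct.mk_surjective A N (ResidueField A)
    IsLocalRing.residue_surjective (b i)
  have hspan := IsLocalRing.span_eq_top_of_tmul_eq_basis v b hv
  have hF : Submodule.span F (Set.range fun i ↦ (1 : F) ⊗ₜ[A] v i) = ⊤ := by
    rw [← Submodule.baseChange_top, ← hspan, Submodule.baseChange_span, ← Set.range_comp]
    rfl
  simpa using finrank_le_of_span_eq_top hF

/-- Extending scalars along a tower with a field in the middle preserves fiber dimension. -/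
theorem finrank_tensorProduct_eq_of_isScalarTower (R M k K : Type*) [CommRing R]
    [AddCommGroup M] [Module R M] [Field k] [Field K] [Algebra R k] [Algebra R K] [Algebra k K]
    [IsScalarTower R k K] :
    Module.finrank K (K ⊗[R] M) = Module.finrank k (k ⊗[R] M) := by
  rw [← (AlgebraTensorModule.cancelBaseChange R k K K M).finrank_eq, Module.finrank_baseChange]

/-- For a finitely generated module `M` over an integral domain `R`, the generic rank
`dim_{Frac R} (Frac R ⊗[R] M)` is at most the fiber dimension `dim_K (K ⊗[R] M)` for
any field `K` that is an `R`-algebra via a ring homomorphism `f : R → K`. -/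
theorem stmt_3 (R : Type*) [CommRing R] [IsDomain R]
    (M : Type*) [AddCommGroup M] [Module R M] [Module.Finite R M]
    (K : Type*) [Field K] (f : R →+* K) :
    letI : Algebra R K := f.toAlgebra
    Module.finrank (FractionRing R) (FractionRing R ⊗[R] M) ≤
      Module.finrank K (K ⊗[R] M) := by
  let : Algebra R K := f.toAlgebra
  let p : Ideal R := RingHom.ker f
  have : p.IsPrime := RingHom.ker_isPrime f
  let A := Localization.AtPrime p
  let : Algebra p.ResidueField K := (Ideal.ResidueField.lift p f le_rfl
    fun x hx ↦ IsUnit.mk0 _ hx).toAlgebra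
  have : IsScalarTower R p.ResidueField K := .of_algebraMap_eq fun x ↦
    (Ideal.ResidueField.lift_algebraMap ..).symm
  have hp : p.primeCompl ≤ (nonZeroDivisors R).comap (RingHom.id R) :=
    p.primeCompl_le_nonZeroDivisors
  let : Algebra A (FractionRing R) :=
    (IsLocalization.map (FractionRing R) (RingHom.id R) hp : A →+* FractionRing R).toAlgebra
  have : IsScalarTower R A (FractionRing R) := .of_algebraMap_eq fun x ↦
    (IsLocalization.map_eq hp x).symm
  calc
    _ = Module.finrank (FractionRing R) (FractionRing R ⊗[A] (A ⊗[R] M)) :=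
      (AlgebraTensorModule.cancelBaseChange R A _ (FractionRing R) M).finrank_eq.symm
    _ ≤ Module.finrank p.ResidueField (p.ResidueField ⊗[A] (A ⊗[R] M)) :=
      IsLocalRing.finrank_tensorProduct_le_finrank_residueField ..
    _ = Module.finrank p.ResidueField (p.ResidueField ⊗[R] M) :=
      (AlgebraTensorModule.cancelBaseChange R A _ p.ResidueField M).finrank_eq
    _ = Module.finrank K (K ⊗[R] M) :=
      (finrank_tensorProduct_eq_of_isScalarTower R M p.ResidueField K).symm
end
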